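/- For all real a with a ∉ πℤ and all real b ≠ 0, ∫_{-∞}^{∞} e^{ibξ} / sinh²(ξ + ia) dξ = −2πb · e^{b[a]_π} / (e^{bπ} − 1), where [a]_π ∈ [0, π) is defined by a = n₀π + [a]_π for some integer n₀. -/

import Mathlib

open MeasureTheory Complex

noncomputable def kf (b : ℝ) (z : ℂ) : ℂ := Complex.exp (I * b * z) / Complex.sinh z ^ 2

lemma sinh_normSq (x y : ℝ) :
    ‖Complex.sinh (x + y * I) ^ 2‖ = Real.sinh x ^ 2 + Real.sin y ^ 2 := by
  have h : Complex.sinh (x + y * I)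
      = ((Real.sinh x * Real.cos y : ℝ) : ℂ) + ((Real.cosh x * Real.sin y : ℝ) : ℂ) * I := by
    rw [Complex.sinh_add, Complex.sinh_mul_I, Complex.cosh_mul_I]
    push_cast
    ring
  rw [norm_pow, h, ← Complex.normSq_eq_norm_sq, Complex.normSq_add_mul_I]
  have h1 := Real.cosh_sq x
  have h2 := Real.sin_sq_add_cos_sq y
  have h3 : Real.cos y ^ 2 = 1 - Real.sin y ^ 2 := by linarith
  rw [mul_pow, mul_pow, h1, h3]
  ring

lemma kf_norm (b x y : ℝ) :
    ‖kf b (x + y * I)‖ = Real.exp (-(b * y)) / (Real.sinh x ^ 2 + Real.sin y ^ 2) := by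
  rw [kf, norm_div, sinh_normSq, Complex.norm_exp]
  congr 2
  simp

lemma sq_le_sinh_sq (x : ℝ) : x ^ 2 ≤ Real.sinh x ^ 2 := by
  rcases le_total 0 x with h | h
  · have := Real.self_le_sinh_iff.2 h
    nlinarith
  · have := Real.sinh_le_self_iff.2 h
    nlinarith

lemma sinh_ne (x y : ℝ) (h0 : 0 < y) (h1 : y < Real.pi) : Complex.sinh (x + y * I) ≠ 0 := by
  intro h
  have := sinh_normSq x y
  rw [h] at this
  have h2 := Real.sin_pos_of_pos_of_lt_pi h0 h1
  simp at this
  have h3 : 0 < Real.sin y ^ 2 := by positivity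
  nlinarith [sq_nonneg (Real.sinh x)]

lemma kf_integrable (b c : ℝ) (h0 : 0 < c) (h1 : c < Real.pi) :
    Integrable (fun x : ℝ => kf b (x + c * I)) := by
  have hs := Real.sin_pos_of_pos_of_lt_pi h0 h1
  refine Integrable.mono' (integrable_inv_one_add_sq.const_mul
    (Real.exp (-(b * c)) / Real.sin c ^ 2)) ?_ ?_
  · apply Continuous.aestronglyMeasurable
    unfold kf
    refine Continuous.div (by fun_prop) (by fun_prop) ?_
    intro x
    exact pow_ne_zero _ (sinh_ne x c h0 h1)
  · refine Filter.Eventually.of_forall fun x => ?_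
    rw [kf_norm, ← div_eq_mul_inv, div_div]
    have := sq_le_sinh_sq x
    have h3 := Real.sin_sq_le_one c
    gcongr
    nlinarith [sq_nonneg x, sq_nonneg (Real.sin c)]

lemma kf_vert (b c T x : ℝ) (h0 : 0 < c) (h1 : c < Real.pi) (hT : 0 < T) (hx : x ^ 2 = T ^ 2) :
    ‖∫ y : ℝ in c..(Real.pi / 2), kf b (x + y * I)‖
      ≤ Real.exp (|b| * Real.pi) / T ^ 2 * |Real.pi / 2 - c| := by
  apply intervalIntegral.norm_integral_le_of_norm_le_const
  intro y hy
  have hp := Real.pi_pos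
  have hy2 : 0 < y ∧ y < Real.pi := by
    rw [Set.mem_uIoc] at hy
    rcases hy with h | h <;> constructor <;> linarith [h.1, h.2]
  rw [kf_norm]
  have := sq_le_sinh_sq x
  have h3 : -(b * y) ≤ |b| * Real.pi := by
    have := neg_abs_le b
    have := abs_nonneg b
    nlinarith [hy2.1, hy2.2]
  gcongr
  nlinarith [sq_nonneg (Real.sin y)]

lemma vert_tendsto (K L : ℝ) :
    Filter.Tendsto (fun T : ℝ => K / T ^ 2 * L) Filter.atTop (nhds 0) := by
  have : Filter.Tendsto (fun T : ℝ => K / T ^ 2) Filter.atTop (nhds 0) :=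
    Filter.Tendsto.const_div_atTop (Filter.tendsto_pow_atTop two_ne_zero) K
  simpa using this.mul_const L

lemma kf_shift (b c : ℝ) (h0 : 0 < c) (h1 : c < Real.pi) :
    ∫ x : ℝ, kf b (x + c * I) = ∫ x : ℝ, kf b (x + (Real.pi / 2 : ℝ) * I) := by
  have hp := Real.pi_pos
  have A := intervalIntegral_tendsto_integral (kf_integrable b c h0 h1)
    Filter.tendsto_neg_atTop_atBot Filter.tendsto_id
  have B := intervalIntegral_tendsto_integral
    (kf_integrable b (Real.pi / 2) (by linarith) (by linarith))
    Filter.tendsto_neg_atTop_atBot Filter.tendsto_id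
  have V1 : Filter.Tendsto (fun T : ℝ => I * ∫ y : ℝ in c..(Real.pi / 2), kf b ((T : ℝ) + y * I))
      Filter.atTop (nhds 0) := by
    refine squeeze_zero_norm' ?_ (vert_tendsto (Real.exp (|b| * Real.pi)) |Real.pi / 2 - c|)
    filter_upwards [Filter.eventually_gt_atTop 0] with T hT
    rw [norm_mul, norm_I, one_mul]
    exact kf_vert b c T T h0 h1 hT rfl
  have V2 : Filter.Tendsto
      (fun T : ℝ => I * ∫ y : ℝ in c..(Real.pi / 2), kf b (((-T : ℝ) : ℂ) + y * I))
      Filter.atTop (nhds 0) := by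
    refine squeeze_zero_norm' ?_ (vert_tendsto (Real.exp (|b| * Real.pi)) |Real.pi / 2 - c|)
    filter_upwards [Filter.eventually_gt_atTop 0] with T hT
    rw [norm_mul, norm_I, one_mul]
    exact kf_vert b c T (-T) h0 h1 hT (by ring)
  have C := ((A.sub B).add V1).sub V2
  have D : ∀ T : ℝ, (∫ x in (-T)..(id T), kf b (x + c * I))
      - (∫ x in (-T)..(id T), kf b (x + (Real.pi / 2 : ℝ) * I))
      + I * (∫ y : ℝ in c..(Real.pi / 2), kf b ((T : ℝ) + y * I))
      - I * (∫ y : ℝ in c..(Real.pi / 2), kf b (((-T : ℝ) : ℂ) + y * I)) = 0 := by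
    intro T
    have := integral_boundary_rect_eq_zero_of_differentiableOn (kf b) ⟨-T, c⟩ ⟨T, Real.pi / 2⟩ ?_
    · simpa only [smul_eq_mul, id] using this
    · intro z hz
      have hz2 : z.im ∈ Set.uIcc c (Real.pi / 2) := hz.2
      have hy2 : 0 < z.im ∧ z.im < Real.pi := by
        rw [Set.mem_uIcc] at hz2
        rcases hz2 with h | h <;> constructor <;> linarith [h.1, h.2]
      have hne := sinh_ne z.re z.im hy2.1 hy2.2
      rw [Complex.re_add_im] at hne
      apply DifferentiableAt.differentiableWithinAt
      unfold kf
      refine DifferentiableAt.div (by fun_prop) ?_ (pow_ne_zero _ hne)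
      exact (Complex.differentiable_sinh z).pow 2
  have E := tendsto_nhds_unique C (by simp only [D]; exact tendsto_const_nhds)
  simpa [sub_eq_zero] using E

lemma sech_integral (b : ℝ) (hb : b ≠ 0) :
    ∫ x : ℝ, Complex.exp (I * b * x) / Complex.cosh x ^ 2
      = Real.pi * b / Complex.sinh (Real.pi * b / 2) := by
  set s : ℂ := I * b / 2 with hs
  have hs0 : s ≠ 0 := by simp [hs, hb]
  have hre : s.re = 0 := by simp [hs]
  have hB := Gamma_mul_Gamma_eq_betaIntegral (s := 1 + s) (t := 1 - s)
    (by simp [hre]) (by simp [hre])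
  have hG : Gamma (1 + s) * Gamma (1 - s) = s * (Real.pi / Complex.sin (Real.pi * s)) := by
    rw [add_comm, Complex.Gamma_add_one s hs0, mul_assoc, Complex.Gamma_mul_Gamma_one_sub]
  have h2 : Gamma ((1 + s) + (1 - s)) = 1 := by
    rw [show (1 + s) + (1 - s) = 1 + 1 by ring, Complex.Gamma_add_one 1 one_ne_zero,
      Complex.Gamma_one, one_mul]
  rw [hG, h2, one_mul, betaIntegral, intervalIntegral.integral_of_le zero_le_one,
    integral_Ioc_eq_integral_Ioo] at hB
  have him : (fun x : ℝ => Real.sigmoid (2 * x)) '' Set.univ = Set.Ioo 0 1 := by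
    rw [← Real.range_sigmoid, Set.image_univ]
    exact (mul_left_surjective₀ (two_ne_zero' ℝ)).range_comp Real.sigmoid
  rw [← him, integral_image_eq_integral_abs_deriv_smul (f' := fun x =>
    Real.sigmoid (2 * x) * (1 - Real.sigmoid (2 * x)) * 2) MeasurableSet.univ] at hB
  rotate_left
  · intro x _
    have h := (Real.hasDerivAt_sigmoid (2 * x)).comp x ((hasDerivAt_id x).const_mul 2)
    simpa using! h
  · intro x _ y _ h
    have := Real.sigmoid_injective h
    linarith
  rw [setIntegral_univ] at hB
  have hint : ∀ x : ℝ, Complex.exp (I * b * x) / Complex.cosh x ^ 2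
     = 2 * (|Real.sigmoid (2 * x) * (1 - Real.sigmoid (2 * x)) * 2| •
      ((Real.sigmoid (2 * x) : ℂ) ^ (1 + s - 1) *
        (1 - (Real.sigmoid (2 * x) : ℂ)) ^ (1 - s - 1))) := by
    intro x
    have hp := Real.sigmoid_pos (2 * x)
    have hq : 0 < 1 - Real.sigmoid (2 * x) := by linarith [Real.sigmoid_lt_one (2 * x)]
    rw [abs_of_pos (by positivity)]
    have hlog : Real.log (Real.sigmoid (2 * x)) - Real.log (1 - Real.sigmoid (2 * x)) = 2 * x := by
      rw [← Real.sigmoid_neg, ← Real.sigmoid_mul_rexp_neg, Real.log_mul hp.ne'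
        (Real.exp_pos _).ne', Real.log_exp]
      ring
    have hcosh : Real.sigmoid (2 * x) * (1 - Real.sigmoid (2 * x)) = 1 / (4 * Real.cosh x ^ 2) := by
      rw [← Real.sigmoid_neg, Real.sigmoid_def, Real.sigmoid_def, ← mul_inv, Real.cosh_eq,
        one_div]
      congr 1
      have e1 : Real.exp (2 * x) = Real.exp x ^ 2 := by rw [← Real.exp_nat_mul]; norm_num
      have e2 : Real.exp (-(2 * x)) = Real.exp (-x) ^ 2 := by
        rw [← Real.exp_nat_mul]; congr 1; push_cast; ring
      have e3 : Real.exp x * Real.exp (-x) = 1 := by rw [← Real.exp_add]; simp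
      rw [neg_neg, e1, e2]
      linear_combination (Real.exp x * Real.exp (-x) + 1 - 2) * e3
    have hpow : (Real.sigmoid (2 * x) : ℂ) ^ (1 + s - 1) *
        (1 - (Real.sigmoid (2 * x) : ℂ)) ^ (1 - s - 1) = Complex.exp (I * b * x) := by
      have hq' : (1 - (Real.sigmoid (2 * x) : ℂ)) = ((1 - Real.sigmoid (2 * x) : ℝ) : ℂ) := by
        push_cast; ring
      rw [hq', Complex.cpow_def_of_ne_zero (by exact_mod_cast hp.ne'),
        Complex.cpow_def_of_ne_zero (by exact_mod_cast hq.ne'), ← Complex.ofReal_log hp.le,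
        ← Complex.ofReal_log hq.le, ← Complex.exp_add]
      congr 1
      have hlog' := congrArg (fun r : ℝ => (r : ℂ)) hlog
      simp only [Complex.ofReal_sub, Complex.ofReal_mul] at hlog' 
      rw [hs]
      push_cast at hlog' ⊢
      linear_combination (I * b / 2) * hlog'
    rw [hpow, hcosh, Complex.real_smul]
    push_cast
    ring
  simp_rw [hint]
  rw [integral_const_mul, ← hB, hs]
  rw [show (Real.pi : ℂ) * (I * b / 2) = (Real.pi * b / 2) * I by ring, Complex.sin_mul_I]
  by_cases h : Complex.sinh (Real.pi * b / 2) = 0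
  · simp [h]
  · field_simp

theorem stmt14
    (a b : ℝ) (ha : ∀ n : ℤ, a ≠ n * Real.pi) (hb : b ≠ 0)
    (aπ : ℝ) (haπ : aπ = Real.pi * Int.fract (a / Real.pi)) :
    (∫ ξ : ℝ, Complex.exp (Complex.I * b * ξ) / Complex.sinh (↑ξ + Complex.I * a) ^ 2)
      = ((-2 * Real.pi * b * Real.exp (b * aπ) / (Real.exp (b * Real.pi) - 1) : ℝ) : ℂ) := by
  have hp := Real.pi_pos
  have hn : a = ⌊a / Real.pi⌋ * Real.pi + aπ := by
    rw [haπ, Int.fract]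
    field_simp
    ring
  generalize ⌊a / Real.pi⌋ = n at hn
  have h1 : aπ < Real.pi := by
    rw [haπ]; nlinarith [Int.fract_lt_one (a / Real.pi)]
  have h0 : 0 < aπ := by
    have : 0 ≤ aπ := by rw [haπ]; exact mul_nonneg hp.le (Int.fract_nonneg _)
    refine lt_of_le_of_ne this fun h => ha n ?_
    rw [hn, ← h, add_zero]
  have e1 : ∀ ξ : ℝ, Complex.exp (I * b * ξ) / Complex.sinh (↑ξ + I * a) ^ 2
      = Complex.exp (b * aπ) * kf b (ξ + aπ * I) := by
    intro ξ
    have hsin : Complex.sin (n * Real.pi) = 0 := Complex.sin_int_mul_pi n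
    have hcos : Complex.cos (n * Real.pi) ^ 2 = 1 := by
      have := Complex.sin_sq_add_cos_sq (n * Real.pi)
      rw [hsin] at this
      simpa using this
    have : (ξ : ℂ) + I * a = (ξ + aπ * I) + (n * Real.pi) * I := by
      rw [hn]; push_cast; ring
    rw [this, Complex.sinh_add, Complex.sinh_mul_I, Complex.cosh_mul_I, hsin, zero_mul, mul_zero,
      add_zero, mul_pow, hcos, mul_one, kf, ← mul_div_assoc, ← Complex.exp_add]
    congr 2
    linear_combination (-(b : ℂ) * aπ) * I_sq
  have e2 : ∀ x : ℝ, kf b (x + (Real.pi / 2 : ℝ) * I)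
      = -Complex.exp (-(b * Real.pi / 2)) * (Complex.exp (I * b * x) / Complex.cosh x ^ 2) := by
    intro x
    rw [kf, Complex.sinh_add, Complex.sinh_mul_I, Complex.cosh_mul_I, ← Complex.ofReal_sin,
      ← Complex.ofReal_cos, Real.sin_pi_div_two, Real.cos_pi_div_two]
    have : I * b * (x + (Real.pi / 2 : ℝ) * I) = -(b * Real.pi / 2) + I * b * x := by
      push_cast
      linear_combination ((b : ℂ) * Real.pi / 2) * I_sq
    rw [this, Complex.exp_add]
    simp only [ofReal_zero, ofReal_one, mul_zero, zero_add, one_mul, mul_pow, I_sq]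
    ring
  simp_rw [e1]
  rw [integral_const_mul, kf_shift b aπ h0 h1]
  simp_rw [e2]
  rw [integral_const_mul, sech_integral b hb]
  have hE : Real.exp (b * Real.pi) - 1 ≠ 0 := by
    rw [sub_ne_zero, Ne, Real.exp_eq_one_iff]
    exact mul_ne_zero hb hp.ne'
  have hS : 2 * Real.sinh (Real.pi * b / 2) * Real.exp (b * Real.pi / 2)
      = Real.exp (b * Real.pi) - 1 := by
    rw [Real.sinh_eq]
    have f1 : Real.exp (b * Real.pi) = Real.exp (Real.pi * b / 2) * Real.exp (b * Real.pi / 2) := by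
      rw [← Real.exp_add]; congr 1; ring
    have f2 : Real.exp (-(Real.pi * b / 2)) * Real.exp (b * Real.pi / 2) = 1 := by
      rw [← Real.exp_add, ← Real.exp_zero]; congr 1; ring
    rw [f1]
    linear_combination -f2
  have hs0 : Real.sinh (Real.pi * b / 2) ≠ 0 := by
    intro h; rw [h] at hS; apply hE; rw [← hS]; ring
  have key : Real.exp (b * aπ) * (-Real.exp (-(b * Real.pi / 2)) *
      (Real.pi * b / Real.sinh (Real.pi * b / 2)))
      = -2 * Real.pi * b * Real.exp (b * aπ) / (Real.exp (b * Real.pi) - 1) := by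
    rw [← hS, Real.exp_neg]
    have := (Real.exp_pos (b * Real.pi / 2)).ne'
    field_simp
  rw [← key]
  push_cast
  rfl
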